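/- For every ρ > 0 there exists a constant C > 0 such that for every x ∈ ℝ and every y ∈ (0,1], one has arctan((x+ρ)/y) − arctan((x−ρ)/y) ≤ C/(1 + x²). -/

import Mathlib

open Real

/-- Mean value theorem for `arctan`. -/
lemma exists_arctan_sub_eq {a b : ℝ} (hab : a < b) :
    ∃ c ∈ Set.Ioo a b, Real.arctan b - Real.arctan a = (b - a) / (1 + c ^ 2) := by
  obtain ⟨c, hc, h⟩ := exists_hasDerivAt_eq_slope Real.arctan (fun x => 1 / (1 + x ^ 2)) hab
    Real.continuous_arctan.continuousOn (fun x _ => Real.hasDerivAt_arctan x)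
  refine ⟨c, hc, ?_⟩
  rw [eq_div_iff (sub_pos.2 hab).ne'] at h
  rw [← h]
  ring

/-- Away from the interval `[-2ρ, 2ρ]` the difference of arctangents decays like `x⁻²`,
uniformly in the scale `y ∈ (0, 1]`. -/
lemma arctan_sub_arctan_le_of_two_mul_le_abs {ρ x y : ℝ} (hρ : 0 < ρ) (hy : 0 < y) (hy1 : y ≤ 1)
    (hx : 2 * ρ ≤ |x|) :
    Real.arctan ((x + ρ) / y) - Real.arctan ((x - ρ) / y) ≤ 8 * ρ / x ^ 2 := by
  have hx0 : 0 < |x| := by linarith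
  have hx2 : 0 < x ^ 2 := by rw [← sq_abs]; positivity
  obtain ⟨c, ⟨hc1, hc2⟩, h⟩ := exists_arctan_sub_eq
    (show (x - ρ) / y < (x + ρ) / y by gcongr; linarith)
  rw [div_lt_iff₀ hy] at hc1
  rw [lt_div_iff₀ hy] at hc2
  have hxc : |x| / 2 ≤ |c * y| := by
    have h1 : |x - c * y| ≤ ρ := abs_le.2 ⟨by linarith, by linarith⟩
    have h2 := abs_sub_abs_le_abs_sub x (c * y)
    linarith
  have hsq : x ^ 2 ≤ 4 * (c * y) ^ 2 := by
    have := pow_le_pow_left₀ (by positivity) hxc 2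
    rw [div_pow, sq_abs, sq_abs] at this
    linarith
  have hyc : y * x ^ 2 ≤ 4 * (y ^ 2 * (1 + c ^ 2)) := by nlinarith [mul_pos hy hx2, sq_nonneg y]
  have hdiff : (x + ρ) / y - (x - ρ) / y = 2 * ρ / y := by ring
  rw [h, hdiff, div_div, div_le_div_iff₀ (by positivity) hx2]
  have : x ^ 2 ≤ 4 * (y * (1 + c ^ 2)) := by
    refine le_of_mul_le_mul_left ?_ hy
    linarith
  nlinarith

/-- For every `ρ > 0` there is `C > 0` such that
`arctan((x+ρ)/y) − arctan((x−ρ)/y) ≤ C/(1+x²)` for all `x ∈ ℝ` and `y ∈ (0,1]`. -/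
theorem statement9 (ρ : ℝ) (hρ : 0 < ρ) :
    ∃ C : ℝ, 0 < C ∧ ∀ x : ℝ, ∀ y ∈ Set.Ioc (0 : ℝ) 1,
      Real.arctan ((x + ρ) / y) - Real.arctan ((x - ρ) / y) ≤ C / (1 + x ^ 2) := by
  refine ⟨π * (1 + 4 * ρ ^ 2) + (8 * ρ + 2 / ρ), by positivity, ?_⟩
  rintro x y ⟨hy, hy1⟩
  rw [le_div_iff₀ (by positivity)]
  have hC1 : 0 < π * (1 + 4 * ρ ^ 2) := by positivity
  have hC2 : 0 < 8 * ρ + 2 / ρ := by positivity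
  rcases le_total (2 * ρ) |x| with hx | hx
  · have hx2 : 4 * ρ ^ 2 ≤ x ^ 2 := by
      rw [← sq_abs x]; nlinarith
    have hx0 : 0 < x ^ 2 := lt_of_lt_of_le (by positivity) hx2
    calc _ ≤ 8 * ρ / x ^ 2 * (1 + x ^ 2) := by
          gcongr
          exact arctan_sub_arctan_le_of_two_mul_le_abs hρ hy hy1 hx
      _ = 8 * ρ + 8 * ρ / x ^ 2 := by rw [mul_add, mul_one, div_mul_cancel₀ _ hx0.ne', add_comm]
      _ ≤ 8 * ρ + 8 * ρ / (4 * ρ ^ 2) := by gcongr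
      _ = 8 * ρ + 2 / ρ := by field_simp; ring
      _ ≤ _ := by linarith
  · have hx2 : x ^ 2 ≤ 4 * ρ ^ 2 := by
      rw [← sq_abs x]; nlinarith [abs_nonneg x]
    have h1 := Real.arctan_lt_pi_div_two ((x + ρ) / y)
    have h2 := Real.neg_pi_div_two_lt_arctan ((x - ρ) / y)
    calc _ ≤ π * (1 + 4 * ρ ^ 2) := by gcongr; linarith
      _ ≤ _ := by linarith
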